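/- arXiv:2303.09437 — 2 statements merged into one kernel-verified Lean document; each statement's English description precedes it below -/
import Mathlib

section
/- Willems' fundamental lemma: Let 𝔅(A,B,C,D) be a discrete-time LTI system with state dimension n_x such that the pair (A,B) is controllable. Let (u_d, y_d) be a T-step trajectory of the system, and suppose the input sequence u_d is persistently exciting of order L + n_x. Then the column span of the stacked Hankel matrix Han_L(u_d, y_d) = [Han_L(u_d); Han_L(y_d)] equals 𝔅_L(A,B,C,D), the set of all L-step trajectories of the system (viewed as vectors in ℝ^{L·n_u + L·n_y}). -/
open Matrix

/-- Hankel matrix of depth `L` of a signal `s : Fin T → Fin ns → ℝ`: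
its `((i,a), j)` entry is `s (i+j) a` (entries out of range, which do not
occur when `L ≤ T`, are set to `0`). -/
noncomputable def hankel {T ns : ℕ} (L : ℕ) (s : Fin T → Fin ns → ℝ) :
    Matrix (Fin L × Fin ns) (Fin (T - L + 1)) ℝ :=
  Matrix.of fun p j =>
    if h : p.1.val + j.val < T then s ⟨p.1.val + j.val, h⟩ p.2 else 0

/-- Stacked Hankel matrix `[Han_L(u); Han_L(y)]`. -/
noncomputable def stackedHankel {T nu ny : ℕ} (L : ℕ)
    (u : Fin T → Fin nu → ℝ) (y : Fin T → Fin ny → ℝ) :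
    Matrix ((Fin L × Fin nu) ⊕ (Fin L × Fin ny)) (Fin (T - L + 1)) ℝ :=
  Matrix.fromRows (hankel L u) (hankel L y)

/-- `(u, y)` is an `L`-step trajectory of the LTI system `𝔅(A,B,C,D)`. -/
def IsTrajectory {nx nu ny : ℕ}
    (A : Matrix (Fin nx) (Fin nx) ℝ) (B : Matrix (Fin nx) (Fin nu) ℝ)
    (C : Matrix (Fin ny) (Fin nx) ℝ) (D : Matrix (Fin ny) (Fin nu) ℝ)
    {L : ℕ} (u : Fin L → Fin nu → ℝ) (y : Fin L → Fin ny → ℝ) : Prop :=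
  ∃ x : Fin L → Fin nx → ℝ,
    (∀ i : Fin L, ∀ h : i.val + 1 < L,
      x ⟨i.val + 1, h⟩ = A.mulVec (x i) + B.mulVec (u i)) ∧
    (∀ i : Fin L, y i = C.mulVec (x i) + D.mulVec (u i))

/-- The set `𝔅_L(A,B,C,D)` of all `L`-step trajectories, identified with
vectors in `ℝ^{L·nu + L·ny}` by concatenating the input and output sequences. -/
def trajSet {nx nu ny : ℕ}
    (A : Matrix (Fin nx) (Fin nx) ℝ) (B : Matrix (Fin nx) (Fin nu) ℝ)
    (C : Matrix (Fin ny) (Fin nx) ℝ) (D : Matrix (Fin ny) (Fin nu) ℝ)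
    (L : ℕ) : Set ((Fin L × Fin nu) ⊕ (Fin L × Fin ny) → ℝ) :=
  {w | ∃ (u : Fin L → Fin nu → ℝ) (y : Fin L → Fin ny → ℝ),
    IsTrajectory A B C D u y ∧
    w = Sum.elim (fun p => u p.1 p.2) (fun p => y p.1 p.2)}

/-- Controllability matrix `[B, AB, …, A^{nx−1}B]`. -/
noncomputable def ctrbMatrix {nx nu : ℕ}
    (A : Matrix (Fin nx) (Fin nx) ℝ) (B : Matrix (Fin nx) (Fin nu) ℝ) :
    Matrix (Fin nx) (Fin nx × Fin nu) ℝ :=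
  Matrix.of fun i p => (A ^ (p.1 : ℕ) * B) i p.2

/-- Extension of a finite signal to `ℕ` by zero. -/
noncomputable def zeroExtend {T ns : ℕ} (s : Fin T → Fin ns → ℝ) (j : ℕ) : Fin ns → ℝ :=
  if h : j < T then s ⟨j, h⟩ else 0

lemma zeroExtend_of_lt {T ns : ℕ} (s : Fin T → Fin ns → ℝ) {j : ℕ} (h : j < T) :
    zeroExtend s j = s ⟨j, h⟩ := dif_pos h

lemma hankel_apply_eq_zeroExtend {T ns L : ℕ} (s : Fin T → Fin ns → ℝ) (p : Fin L × Fin ns)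
    (j : Fin (T - L + 1)) : hankel L s p j = zeroExtend s (p.1 + j) p.2 := by
  simp only [hankel, zeroExtend, Matrix.of_apply]
  split_ifs <;> rfl

lemma hankel_mulVec_apply {T ns L : ℕ} (s : Fin T → Fin ns → ℝ) (g : Fin (T - L + 1) → ℝ)
    (p : Fin L × Fin ns) :
    (hankel L s *ᵥ g) p = (∑ j, g j • zeroExtend s (p.1 + j)) p.2 := by
  simp [Matrix.mulVec, dotProduct, hankel_apply_eq_zeroExtend, Finset.sum_apply, mul_comm]

/-- State sequence on `ℕ` of a linear system with a given initial state and input. -/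
noncomputable def stateSeq {nx nu : ℕ} (A : Matrix (Fin nx) (Fin nx) ℝ)
    (B : Matrix (Fin nx) (Fin nu) ℝ) (x₀ : Fin nx → ℝ) (u : ℕ → Fin nu → ℝ) : ℕ → Fin nx → ℝ
  | 0 => x₀
  | j + 1 => A *ᵥ stateSeq A B x₀ u j + B *ᵥ u j

lemma Matrix.vecMul_eq_zero_of_rank_eq_card {m n : Type*} [Fintype m] [Fintype n]
    {M : Matrix m n ℝ} (h : M.rank = Fintype.card m) {w : m → ℝ} (hw : w ᵥ* M = 0) : w = 0 := by
  have hli : LinearIndependent ℝ M.row := by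
    rw [linearIndependent_iff_card_eq_finrank_span, ← h, Matrix.rank_eq_finrank_span_row]
    rfl
  exact Matrix.vecMul_injective_iff.mpr hli (by simpa using hw)

lemma Matrix.mulVec_surjective_of_vecMul_eq_zero {m n : Type*} [Fintype m] [Fintype n]
    {M : Matrix m n ℝ} (h : ∀ w, w ᵥ* M = 0 → w = 0) : Function.Surjective M.mulVec := by
  have hli : LinearIndependent ℝ M.row := by
    rw [← Matrix.vecMul_injective_iff]
    exact (injective_iff_map_eq_zero M.vecMulLinear).mpr h
  have hr := hli.rank_matrix
  have : LinearMap.range M.mulVecLin = ⊤ := by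
    apply Submodule.eq_top_of_finrank_eq
    rw [Module.finrank_fintype_fun_eq_card, ← hr]
    rfl
  exact LinearMap.range_eq_top.mp this

/-- If `x` is a state sequence of `(A, B)` with input `u`, the functional
`ξ ⬝ᵥ x (j + k) + ∑ i, η i ⬝ᵥ u (j + k + i)` of the state and inputs at time `j + k` is the
functional of those at time `j` with state part `ξ ᵥ* A ^ k` and input part
`shiftedInputCoeff A B ξ η k`. -/
noncomputable def shiftedInputCoeff {nx nu : ℕ} (A : Matrix (Fin nx) (Fin nx) ℝ)
    (B : Matrix (Fin nx) (Fin nu) ℝ) (ξ : Fin nx → ℝ) (η : ℕ → Fin nu → ℝ) (k p : ℕ) :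
    Fin nu → ℝ :=
  if p < k then ξ ᵥ* (A ^ (k - 1 - p) * B) else η (p - k)

section

variable {nx nu : ℕ} {A : Matrix (Fin nx) (Fin nx) ℝ} {B : Matrix (Fin nx) (Fin nu) ℝ}
  {x : ℕ → Fin nx → ℝ} {u : ℕ → Fin nu → ℝ}

lemma state_add_eq (hx : ∀ j, x (j + 1) = A *ᵥ x j + B *ᵥ u j) (j k : ℕ) :
    x (j + k) = A ^ k *ᵥ x j + ∑ i ∈ Finset.range k, (A ^ (k - 1 - i) * B) *ᵥ u (j + i) := by
  induction k with
  | zero => simp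
  | succ k ih =>
    rw [← add_assoc, hx, ih, Finset.sum_range_succ, Matrix.mulVec_add, Matrix.mulVec_mulVec,
      ← pow_succ', Matrix.mulVec_sum, add_assoc]
    congr 2
    · refine Finset.sum_congr rfl fun i hi => ?_
      have hi := Finset.mem_range.mp hi
      rw [Matrix.mulVec_mulVec, ← Matrix.mul_assoc, ← pow_succ']
      congr 3
      omega
    · simp

lemma dotProduct_state_add_eq (hx : ∀ j, x (j + 1) = A *ᵥ x j + B *ᵥ u j) {L k n : ℕ}
    (hk : k ≤ n) (ξ : Fin nx → ℝ) {η : ℕ → Fin nu → ℝ} (hη : ∀ i, L ≤ i → η i = 0) (j : ℕ) :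
    ξ ⬝ᵥ x (j + k) + ∑ i ∈ Finset.range L, η i ⬝ᵥ u (j + k + i) =
      (ξ ᵥ* A ^ k) ⬝ᵥ x j +
        ∑ p ∈ Finset.range (L + n), shiftedInputCoeff A B ξ η k p ⬝ᵥ u (j + p) := by
  obtain ⟨d, rfl⟩ := Nat.exists_eq_add_of_le hk
  rw [show L + (k + d) = k + L + d by omega, Finset.sum_range_add _ (k + L) d,
    Finset.sum_range_add _ k L, state_add_eq hx, dotProduct_add, Matrix.dotProduct_mulVec,
    dotProduct_sum, add_assoc]
  congr 1
  rw [Finset.sum_eq_zero (s := Finset.range d), add_zero]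
  · congr 1
    · refine Finset.sum_congr rfl fun i hi => ?_
      rw [shiftedInputCoeff, if_pos (Finset.mem_range.mp hi), Matrix.dotProduct_mulVec]
    · refine Finset.sum_congr rfl fun i _ => ?_
      rw [shiftedInputCoeff, if_neg (by omega), Nat.add_sub_cancel_left, add_assoc]
  · intro i _
    rw [shiftedInputCoeff, if_neg (by omega), hη _ (by omega), zero_dotProduct]

/-- Rows annihilating the state and input data vanish when the input is persistently exciting. -/
lemma state_input_coeff_eq_zero (hx : ∀ j, x (j + 1) = A *ᵥ x j + B *ᵥ u j)
    (hctrb : (ctrbMatrix A B).rank = nx) {L N : ℕ}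
    (hPE : ∀ w : ℕ → Fin nu → ℝ,
      (∀ j ≤ N, ∑ p ∈ Finset.range (L + nx), w p ⬝ᵥ u (j + p) = 0) → ∀ p < L + nx, w p = 0)
    {ξ : Fin nx → ℝ} {η : ℕ → Fin nu → ℝ} (hη : ∀ i, L ≤ i → η i = 0)
    (h : ∀ j ≤ N + nx, ξ ⬝ᵥ x j + ∑ i ∈ Finset.range L, η i ⬝ᵥ u (j + i) = 0) :
    ξ = 0 ∧ η = 0 := by
  set a := A.charpoly.coeff
  have hdeg : A.charpoly.natDegree = nx := by simp
  have hlead : a nx = 1 := by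
    have := A.charpoly_monic.coeff_natDegree
    rwa [hdeg] at this
  have hCH : ∑ k ∈ Finset.range (nx + 1), a k • A ^ k = 0 := by
    have := A.aeval_self_charpoly
    rwa [Polynomial.aeval_eq_sum_range, hdeg] at this
  have hcomb : ∀ p < L + nx,
      ∑ k ∈ Finset.range (nx + 1), a k • shiftedInputCoeff A B ξ η k p = 0 := by
    refine hPE _ fun j hj => ?_
    have hsum : ∑ k ∈ Finset.range (nx + 1), a k * ((ξ ᵥ* A ^ k) ⬝ᵥ x j +
        ∑ p ∈ Finset.range (L + nx), shiftedInputCoeff A B ξ η k p ⬝ᵥ u (j + p)) = 0 := by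
      refine Finset.sum_eq_zero fun k hk => ?_
      have hk := Finset.mem_range_succ_iff.mp hk
      rw [← dotProduct_state_add_eq hx hk ξ hη, h (j + k) (by omega), mul_zero]
    have hstate : ∑ k ∈ Finset.range (nx + 1), a k * ((ξ ᵥ* A ^ k) ⬝ᵥ x j) = 0 := by
      have : (ξ ᵥ* ∑ k ∈ Finset.range (nx + 1), a k • A ^ k) ⬝ᵥ x j = 0 := by simp [hCH]
      simpa [Matrix.vecMul_sum, sum_dotProduct, Matrix.vecMul_smul] using this
    simp only [mul_add, Finset.sum_add_distrib, hstate, zero_add, Finset.mul_sum] at hsum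
    rw [Finset.sum_comm] at hsum
    simpa [sum_dotProduct] using hsum
  have hzero : ∀ q, ∀ p < L + nx, L + nx - p = q → shiftedInputCoeff A B ξ η nx p = 0 := by
    intro q
    induction q using Nat.strong_induction_on with
    | _ q ih =>
      intro p hp hq
      have hc := hcomb p hp
      rw [Finset.sum_range_succ, hlead, one_smul, Finset.sum_eq_zero, zero_add] at hc
      · exact hc
      intro k hk
      have hk := Finset.mem_range.mp hk
      have hshift : shiftedInputCoeff A B ξ η k p =
          shiftedInputCoeff A B ξ η nx (p + (nx - k)) := by
        simp only [shiftedInputCoeff]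
        split_ifs
        · congr 3
          omega
        · omega
        · omega
        · congr 1
          omega
      rw [hshift]
      by_cases hlt : p + (nx - k) < L + nx
      · rw [ih (L + nx - (p + (nx - k))) (by omega) _ hlt rfl, smul_zero]
      · rw [shiftedInputCoeff, if_neg (by omega), hη _ (by omega), smul_zero]
  constructor
  · refine Matrix.vecMul_eq_zero_of_rank_eq_card (M := ctrbMatrix A B) (by simpa using hctrb) ?_
    ext ⟨i, b⟩
    have hi := hzero _ (nx - 1 - i) (by omega) rfl
    rw [shiftedInputCoeff, if_pos (by omega),
      show nx - 1 - (nx - 1 - (i : ℕ)) = i by omega] at hi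
    exact congrFun hi b
  · ext1 i
    by_cases hi : i < L
    · have := hzero _ (nx + i) (by omega) rfl
      rwa [shiftedInputCoeff, if_neg (by omega), Nat.add_sub_cancel_left] at this
    · exact hη i (by omega)

end

lemma eq_zero_of_sum_dotProduct_zeroExtend_eq_zero {T nu K : ℕ} {s : Fin T → Fin nu → ℝ}
    (hPE : (hankel K s).rank = K * nu) {w : ℕ → Fin nu → ℝ}
    (hw : ∀ j ≤ T - K, ∑ p ∈ Finset.range K, w p ⬝ᵥ zeroExtend s (j + p) = 0) :
    ∀ p < K, w p = 0 := by
  have h0 : (fun q : Fin K × Fin nu => w q.1 q.2) = 0 := by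
    refine Matrix.vecMul_eq_zero_of_rank_eq_card (M := hankel K s) (by simpa using hPE) ?_
    ext j
    have := hw j (by omega)
    rw [Finset.sum_range] at this
    simpa [Matrix.vecMul, dotProduct, hankel_apply_eq_zeroExtend, Fintype.sum_prod_type,
      add_comm] using this
  intro p hp
  ext b
  exact congrFun h0 (⟨p, hp⟩, b)

lemma le_of_rank_hankel_eq {T nu K : ℕ} {s : Fin T → Fin nu → ℝ} (hnu : 0 < nu)
    (hPE : (hankel K s).rank = K * nu) : K ≤ T := by
  by_contra! hKT
  have := eq_zero_of_sum_dotProduct_zeroExtend_eq_zero hPE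
    (w := fun p => if p = T then 1 else 0) (fun j hj => Finset.sum_eq_zero fun p _ => ?_) T hKT
  · simpa using congrFun this ⟨0, hnu⟩
  · split_ifs with hp
    · simp [zeroExtend, hp]
    · simp

/-- **Willems' fundamental lemma.** If `(A,B)` is controllable, `(u_d, y_d)` is a
`T`-step trajectory of `𝔅(A,B,C,D)` and `u_d` is persistently exciting of order
`L + nx`, then the column span of the stacked Hankel matrix of depth `L` equals
the set of all `L`-step trajectories of the system. -/
theorem willems_fundamental_lemma
    {nx nu ny T L : ℕ}
    (A : Matrix (Fin nx) (Fin nx) ℝ) (B : Matrix (Fin nx) (Fin nu) ℝ)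
    (C : Matrix (Fin ny) (Fin nx) ℝ) (D : Matrix (Fin ny) (Fin nu) ℝ)
    (u_d : Fin T → Fin nu → ℝ) (y_d : Fin T → Fin ny → ℝ)
    (hLT : L ≤ T)
    (hctrb : (ctrbMatrix A B).rank = nx)
    (htraj : IsTrajectory A B C D u_d y_d)
    (hPE : (hankel (L + nx) u_d).rank = (L + nx) * nu) :
    Set.range (stackedHankel L u_d y_d).mulVec = trajSet A B C D L := by
  obtain ⟨x, hx, hy⟩ := htraj
  have hK : L + nx ≤ T := by
    rcases Nat.eq_zero_or_pos nu with rfl | hnu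
    · have : (ctrbMatrix A B).rank ≤ Fintype.card (Fin nx × Fin 0) := Matrix.rank_le_card_width _
      simp only [Fintype.card_prod, Fintype.card_fin, mul_zero] at this
      omega
    · exact le_of_rank_hankel_eq hnu hPE
  set U := zeroExtend u_d
  have hU : ∀ j (hj : j < T), U j = u_d ⟨j, hj⟩ := fun j hj => zeroExtend_of_lt u_d hj
  set X := stateSeq A B (zeroExtend x 0) U
  have hXs : ∀ j, X (j + 1) = A *ᵥ X j + B *ᵥ U j := fun j => rfl
  have hXx : ∀ j (hj : j < T), X j = x ⟨j, hj⟩ := by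
    intro j
    induction j with
    | zero => exact fun hj => zeroExtend_of_lt x hj
    | succ j ih =>
      intro hj
      rw [hXs, ih (by omega), hU j (by omega)]
      exact (hx ⟨j, by omega⟩ hj).symm
  have hY : ∀ j < T, zeroExtend y_d j = C *ᵥ X j + D *ᵥ U j := by
    intro j hj
    rw [zeroExtend_of_lt y_d hj, hU j hj, hXx j hj, hy]
  -- linear combinations of shifted data are again trajectories
  have hcombX : ∀ (g : Fin (T - L + 1) → ℝ) (i : ℕ), ∑ j, g j • X (i + 1 + j) =
      A *ᵥ (∑ j, g j • X (i + j)) + B *ᵥ ∑ j, g j • U (i + j) := by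
    intro g i
    simp only [Matrix.mulVec_sum, Matrix.mulVec_smul, ← Finset.sum_add_distrib, ← smul_add,
      ← hXs, add_right_comm]
  have hcombY : ∀ (g : Fin (T - L + 1) → ℝ) (i : Fin L), ∑ j, g j • zeroExtend y_d (i + j) =
      C *ᵥ (∑ j, g j • X (i + j)) + D *ᵥ ∑ j, g j • U (i + j) := by
    intro g i
    simp only [Matrix.mulVec_sum, Matrix.mulVec_smul, ← Finset.sum_add_distrib, ← smul_add]
    exact Finset.sum_congr rfl fun j _ => by rw [hY _ (by omega)]
  have hmul : ∀ g : Fin (T - L + 1) → ℝ, stackedHankel L u_d y_d *ᵥ g =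
      Sum.elim (fun p => (∑ j, g j • U (p.1 + j)) p.2)
        (fun p => (∑ j, g j • zeroExtend y_d (p.1 + j)) p.2) := by
    intro g
    rw [stackedHankel, Matrix.fromRows_mulVec]
    congr 1 <;> ext p <;> exact hankel_mulVec_apply _ _ _
  apply Set.Subset.antisymm
  · rintro _ ⟨g, rfl⟩
    exact ⟨fun i => ∑ j, g j • U (i + j), fun i => ∑ j, g j • zeroExtend y_d (i + j),
      ⟨fun i => ∑ j, g j • X (i + j), fun i _ => hcombX g i, hcombY g⟩, hmul g⟩
  · rintro _ ⟨u, y, ⟨z, hz, hzy⟩, rfl⟩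
    let M : Matrix (Fin nx ⊕ (Fin L × Fin nu)) (Fin (T - L + 1)) ℝ :=
      Matrix.fromRows (Matrix.of fun a j => X j a) (hankel L u_d)
    have hM : Function.Surjective M.mulVec := by
      refine Matrix.mulVec_surjective_of_vecMul_eq_zero fun w hw => ?_
      obtain ⟨hξ, hη⟩ := state_input_coeff_eq_zero hXs hctrb (L := L) (N := T - (L + nx))
        (fun w hw => eq_zero_of_sum_dotProduct_zeroExtend_eq_zero hPE hw)
        (ξ := fun a => w (.inl a)) (η := zeroExtend fun i b => w (.inr (i, b)))
        (fun i hi => dif_neg (by omega)) (fun j hj => by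
          have := congrFun hw ⟨j, by omega⟩
          simpa [M, Matrix.vecMul, dotProduct, hankel_apply_eq_zeroExtend,
            Fintype.sum_prod_type, Finset.sum_range, zeroExtend_of_lt, add_comm, U] using this)
      ext (a | ⟨i, b⟩)
      · exact congrFun hξ a
      · have := congrFun (congrFun hη i) b
        rwa [zeroExtend_of_lt _ i.isLt] at this
    obtain ⟨g, hg⟩ := hM (Sum.elim (zeroExtend z 0) fun p => u p.1 p.2)
    rw [Matrix.fromRows_mulVec] at hg
    have hg0 : ∑ j : Fin (T - L + 1), g j • X (0 + j) = zeroExtend z 0 := by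
      ext a
      simpa [Matrix.mulVec, dotProduct, mul_comm] using congrFun hg (.inl a)
    have hgU : ∀ i : Fin L, ∑ j, g j • U (i + j) = u i := by
      intro i
      ext b
      rw [← hankel_mulVec_apply u_d g (i, b)]
      exact congrFun hg (.inr (i, b))
    have hgX : ∀ i (hi : i < L), ∑ j, g j • X (i + j) = z ⟨i, hi⟩ := by
      intro i
      induction i with
      | zero => exact fun hi => hg0.trans (zeroExtend_of_lt z hi)
      | succ i ih =>
        intro hi
        rw [hcombX, ih (by omega), hgU ⟨i, by omega⟩]
        exact (hz ⟨i, by omega⟩ hi).symm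
    refine ⟨g, ?_⟩
    rw [hmul]
    congr 1 <;> ext ⟨i, b⟩
    · rw [hgU]
    · rw [hcombY, hgU, hgX i i.isLt, hzy]
end

section
/- Easy inclusion of the fundamental lemma: Let 𝔅(A,B,C,D) be a discrete-time LTI system and let (u_d, y_d) be a T-step trajectory of the system. Then for any L ≤ T, every vector in the column span of the stacked Hankel matrix Han_L(u_d, y_d) = [Han_L(u_d); Han_L(y_d)] is an L-step trajectory of the system; that is, colspan(Han_L(u_d, y_d)) ⊆ 𝔅_L(A,B,C,D). No persistent-excitation or controllability assumption is needed. -/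
open Matrix

/-- The linear combination, with weights `g`, of the length-`L` windows of the signal `s`. -/
noncomputable def windowCombination {T ns L : ℕ} (hLT : L ≤ T) (s : Fin T → Fin ns → ℝ)
    (g : Fin (T - L + 1) → ℝ) : Fin L → Fin ns → ℝ :=
  fun i => ∑ j : Fin (T - L + 1), g j • s ⟨i.val + j.val, by omega⟩

lemma hankel_mulVec {T ns L : ℕ} (hLT : L ≤ T) (s : Fin T → Fin ns → ℝ)
    (g : Fin (T - L + 1) → ℝ) (p : Fin L × Fin ns) :
    (hankel L s).mulVec g p = windowCombination hLT s g p.1 p.2 := by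
  simp only [windowCombination, Matrix.mulVec, dotProduct, hankel, Matrix.of_apply,
    Finset.sum_apply, Pi.smul_apply, smul_eq_mul]
  refine Finset.sum_congr rfl fun j _ => ?_
  rw [dif_pos (by omega), mul_comm]

/-- Linear combinations of the windows of a trajectory are trajectories. -/
lemma IsTrajectory.windowCombination {nx nu ny T L : ℕ}
    {A : Matrix (Fin nx) (Fin nx) ℝ} {B : Matrix (Fin nx) (Fin nu) ℝ}
    {C : Matrix (Fin ny) (Fin nx) ℝ} {D : Matrix (Fin ny) (Fin nu) ℝ}
    {u : Fin T → Fin nu → ℝ} {y : Fin T → Fin ny → ℝ}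
    (h : IsTrajectory A B C D u y) (hLT : L ≤ T) (g : Fin (T - L + 1) → ℝ) :
    IsTrajectory A B C D (_root_.windowCombination hLT u g)
      (_root_.windowCombination hLT y g) := by
  obtain ⟨x, hx, hy⟩ := h
  refine ⟨_root_.windowCombination hLT x g, fun i hi => ?_, fun i => ?_⟩
  · simp only [_root_.windowCombination, Matrix.mulVec_sum, Matrix.mulVec_smul,
      ← Finset.sum_add_distrib, ← smul_add]
    refine Finset.sum_congr rfl fun j _ => ?_
    rw [← hx ⟨i.val + j.val, by omega⟩ (by simp only; omega)]
    simp only [Nat.add_right_comm]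
  · simp only [_root_.windowCombination, Matrix.mulVec_sum, Matrix.mulVec_smul,
      ← Finset.sum_add_distrib, ← smul_add, hy]

/-- **Easy inclusion of the fundamental lemma.** If `(u_d, y_d)` is a `T`-step
trajectory of `𝔅(A,B,C,D)`, then for any `L ≤ T` every vector in the column
span of the stacked Hankel matrix of depth `L` is an `L`-step trajectory of the
system. No persistent excitation or controllability is assumed. -/
theorem colspan_subset_trajSet
    {nx nu ny T L : ℕ}
    (A : Matrix (Fin nx) (Fin nx) ℝ) (B : Matrix (Fin nx) (Fin nu) ℝ)
    (C : Matrix (Fin ny) (Fin nx) ℝ) (D : Matrix (Fin ny) (Fin nu) ℝ)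
    (u_d : Fin T → Fin nu → ℝ) (y_d : Fin T → Fin ny → ℝ)
    (hLT : L ≤ T)
    (htraj : IsTrajectory A B C D u_d y_d) :
    Set.range (stackedHankel L u_d y_d).mulVec ⊆ trajSet A B C D L := by
  rintro _ ⟨g, rfl⟩
  refine ⟨windowCombination hLT u_d g, windowCombination hLT y_d g,
    htraj.windowCombination hLT g, ?_⟩
  rw [stackedHankel, Matrix.fromRows_mulVec]
  exact congrArg₂ Sum.elim (funext (hankel_mulVec hLT u_d g)) (funext (hankel_mulVec hLT y_d g))
end
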